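/- For a permutation ω ∈ S_n, all reduced pipe dreams of Π(0ω) are acyclic if and only if ω is dominant, i.e., ω avoids the pattern 132 (there are no positions p < q < r with ω(p) < ω(r) < ω(q)). -/

import Mathlib

/-- A pipe dream of size `n` on the triangular shape, with boxes indexed by pairs
`(r, c)` of a row `r` and a column `c`, both `0`-indexed (rows increase southwards,
columns increase eastwards).  `cross r c = true` means that box `(r, c)` contains a
crossing tile; all other boxes contain elbow tiles.  Crossings are only allowed in
the full boxes of the triangular shape, i.e. those with `r + c + 2 ≤ n` (the boxes
with `r + c + 1 = n` are the half-boxes on the antidiagonal, which are forced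
elbows).  The `n` pipes enter horizontally on the left side in rows `0, …, n-1` and
exit vertically on the top side in columns `0, …, n-1`; pipe `k` is the pipe
entering at row `k`.  An elbow tile connects the west edge of its box to the north
edge (the pipe travelling through this elbow passes northwest of the tile) and the
south edge to the east edge (this pipe passes southeast of the tile); a crossing
tile connects west to east and south to north. -/
structure PipeDream (n : ℕ) where
  cross : ℕ → ℕ → Bool
  inShape : ∀ r c : ℕ, cross r c = true → r + c + 2 ≤ n

namespace PipeDream

variable {n : ℕ}

/-- `(P.pipes r c).1` is the label of the pipe entering box `(r, c)` from the west,
and `(P.pipes r c).2` is the label of the pipe entering box `(r, c)` from the south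
(junk value `0` if there is no box below box `(r, c)` in the triangular shape). -/
def pipes (P : PipeDream n) : ℕ → ℕ → ℕ × ℕ
  | r, c =>
    (if hc : c = 0 then r
      else if P.cross r (c - 1) then (pipes P r (c - 1)).1 else (pipes P r (c - 1)).2,
     if hr : r + c + 2 ≤ n then
        if P.cross (r + 1) c then (pipes P (r + 1) c).2 else (pipes P (r + 1) c).1
      else 0)
  termination_by r c => (n - r) + c
  decreasing_by all_goals omega

/-- The pipe entering box `(r, c)` from the west (travelling eastwards). -/
def west (P : PipeDream n) (r c : ℕ) : ℕ := (pipes P r c).1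

/-- The pipe entering box `(r, c)` from the south (travelling northwards). -/
def south (P : PipeDream n) (r c : ℕ) : ℕ := (pipes P r c).2

/-- The pipe exiting on the top side at column `c`. -/
def exitPipe (P : PipeDream n) (c : ℕ) : ℕ :=
  if P.cross 0 c then P.south 0 c else P.west 0 c

/-- `P` has exit permutation `ω`, i.e. the pipe exiting at column `c` is `ω c`;
equivalently, pipe `k` exits at column `ω⁻¹ k`. -/
def HasExitPerm (P : PipeDream n) (ω : Equiv.Perm (Fin n)) : Prop :=
  ∀ c : Fin n, P.exitPipe c.val = (ω c).val

/-- `P` is reduced: any two of its pipes cross at most once. -/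
def Reduced (P : PipeDream n) : Prop :=
  ∀ r c r' c' : ℕ, P.cross r c = true → P.cross r' c' = true → (r, c) ≠ (r', c') →
    ¬ ((P.west r c = P.west r' c' ∧ P.south r c = P.south r' c') ∨
        (P.west r c = P.south r' c' ∧ P.south r c = P.west r' c'))

/-- The arcs of the contact graph `P♯` of `P`: there is one arc for each elbow
contact of `P` (an elbow tile in a full box of the triangular shape), oriented from
the pipe passing northwest of the contact (the one travelling west-to-north) to the
pipe passing southeast of it (the one travelling south-to-east). -/
def Arc (P : PipeDream n) (i j : ℕ) : Prop :=
  ∃ r c : ℕ, r + c + 2 ≤ n ∧ P.cross r c = false ∧ P.west r c = i ∧ P.south r c = j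

/-- `P` is acyclic: its contact graph has no directed cycle. -/
def Acyclic (P : PipeDream n) : Prop := ∀ i : ℕ, ¬ Relation.TransGen P.Arc i i

/-- `i ⪯_P j` : there is a directed path (possibly empty) from `i` to `j` in the
contact graph of `P`. -/
def Path (P : PipeDream n) (i j : ℕ) : Prop := Relation.ReflTransGen P.Arc i j

/-- `π` is a linear extension of `P` : `π⁻¹ i < π⁻¹ j` for every arc `i → j` of the
contact graph of `P`. -/
def LinExt (P : PipeDream n) (π : Equiv.Perm (Fin n)) : Prop :=
  ∀ i j : Fin n, P.Arc i.val j.val → π⁻¹ i < π⁻¹ j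

/-- There is a contact (an elbow tile in a full box) between pipes `i` and `j`
at box `b`. -/
def ContactAt (P : PipeDream n) (i j : ℕ) (b : ℕ × ℕ) : Prop :=
  b.1 + b.2 + 2 ≤ n ∧ P.cross b.1 b.2 = false ∧
    ((P.west b.1 b.2 = i ∧ P.south b.1 b.2 = j) ∨
      (P.west b.1 b.2 = j ∧ P.south b.1 b.2 = i))

/-- `P'` is obtained from `P` by the flip exchanging the contact at box `b` with the
crossing at box `b'` (a contact and a crossing between the same two pipes). -/
def IsFlip (P P' : PipeDream n) (b b' : ℕ × ℕ) : Prop :=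
  b ≠ b' ∧
  P.cross b.1 b.2 = false ∧ P.cross b'.1 b'.2 = true ∧
  P'.cross b.1 b.2 = true ∧ P'.cross b'.1 b'.2 = false ∧
  (∀ r c : ℕ, (r, c) ≠ b → (r, c) ≠ b' → P.cross r c = P'.cross r c) ∧
  ((P.west b.1 b.2 = P.west b'.1 b'.2 ∧ P.south b.1 b.2 = P.south b'.1 b'.2) ∨
    (P.west b.1 b.2 = P.south b'.1 b'.2 ∧ P.south b.1 b.2 = P.west b'.1 b'.2))

/-- There is an increasing flip from `P` to `P'`: a flip exchanging a contact at a
box `b` weakly southwest of the box `b'` of the corresponding crossing. -/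
def IncFlip (P P' : PipeDream n) : Prop :=
  ∃ b b' : ℕ × ℕ, P.IsFlip P' b b' ∧ b'.1 ≤ b.1 ∧ b.2 ≤ b'.2

end PipeDream

/-- The weak order on permutations of `Fin n` : `π ≤ σ` if and only if
`Inv(π) ⊆ Inv(σ)`, where `Inv(π)` is the set of pairs `(i, j)` with `i < j` and
`π⁻¹ i > π⁻¹ j`. -/
def WeakLE {n : ℕ} (π σ : Equiv.Perm (Fin n)) : Prop :=
  ∀ i j : Fin n, i < j → π⁻¹ j < π⁻¹ i → σ⁻¹ j < σ⁻¹ i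


namespace PipeDream

variable {N : ℕ}

/-- the pipe leaving box `(r, c)` through its north edge -/
def north (P : PipeDream N) (r c : ℕ) : ℕ := if P.cross r c then P.south r c else P.west r c

lemma west_zero (P : PipeDream N) (r : ℕ) : P.west r 0 = r := by
  unfold west; rw [pipes]; simp

lemma west_succ (P : PipeDream N) (r c : ℕ) :
    P.west r (c+1) = if P.cross r c then P.west r c else P.south r c := by
  unfold west south; conv_lhs => rw [pipes]
  simp

lemma south_eq (P : PipeDream N) {r c : ℕ} (h : r + c + 2 ≤ N) :
    P.south r c = P.north (r+1) c := by
  unfold north west south; conv_lhs => rw [pipes]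
  simp [h]

lemma exitPipe_eq (P : PipeDream N) (c : ℕ) : P.exitPipe c = P.north 0 c := rfl

lemma north_cross (P : PipeDream N) {r c : ℕ} (h : P.cross r c = true) :
    P.north r c = P.south r c := by simp [north, h]

lemma north_elbow (P : PipeDream N) {r c : ℕ} (h : P.cross r c = false) :
    P.north r c = P.west r c := by simp [north, h]

lemma west_succ_cross (P : PipeDream N) {r c : ℕ} (h : P.cross r c = true) :
    P.west r (c+1) = P.west r c := by simp [west_succ, h]

lemma west_succ_elbow (P : PipeDream N) {r c : ℕ} (h : P.cross r c = false) :
    P.west r (c+1) = P.south r c := by simp [west_succ, h]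

lemma cross_false (P : PipeDream N) {r c : ℕ} (h : N < r + c + 2) : P.cross r c = false := by
  by_contra h'
  have := P.inShape r c (by simpa using h')
  omega

/-- Following a pipe entering a box from the west. -/
lemma follow (P : PipeDream N) (r : ℕ) : ∀ k e : ℕ, r + e + 1 + k = N →
    ∃ x, e ≤ x ∧ r + x + 1 ≤ N ∧ P.north r x = P.west r e ∧
      (∀ v, e ≤ v → v ≤ x → P.west r v = P.west r e) ∧
      (∀ v, e ≤ v → v < x → P.cross r v = true) ∧ P.cross r x = false := by
  intro k
  induction k with
  | zero =>
    intro e he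
    have hc : P.cross r e = false := P.cross_false (by omega)
    refine ⟨e, le_rfl, by omega, P.north_elbow hc, ?_, ?_, hc⟩
    · intro v h1 h2; rw [le_antisymm h2 h1]
    · intro v h1 h2; omega
  | succ k ih =>
    intro e he
    by_cases hc : P.cross r e = true
    · obtain ⟨x, h1, h2, h3, h4, h5, h6⟩ := ih (e+1) (by omega)
      rw [P.west_succ_cross hc] at h3 h4
      refine ⟨x, by omega, h2, h3, ?_, ?_, h6⟩
      · intro v hv hv'
        rcases Nat.eq_or_lt_of_le hv with h | h
        · rw [h]
        · exact h4 v h hv'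
      · intro v hv hv'
        rcases Nat.eq_or_lt_of_le hv with h | h
        · rw [← h]; exact hc
        · exact h5 v h hv'
    · have hc : P.cross r e = false := by simpa using hc
      refine ⟨e, le_rfl, by omega, P.north_elbow hc, ?_, ?_, hc⟩
      · intro v h1 h2; rw [le_antisymm h2 h1]
      · intro v h1 h2; omega

/-- Following a pipe entering a box from the south. -/
lemma follow_south (P : PipeDream N) {r z : ℕ} (hz : r + z + 2 ≤ N) :
    ∃ x, z ≤ x ∧ r + x + 1 ≤ N ∧ P.north r x = P.south r z ∧
      (∀ v, z < v → v ≤ x → P.west r v = P.south r z) ∧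
      (∀ v, z < v → v < x → P.cross r v = true) ∧ (z < x → P.cross r x = false) ∧
      (z = x → P.cross r z = true) := by
  by_cases hc : P.cross r z = true
  · refine ⟨z, le_rfl, by omega, P.north_cross hc, ?_, ?_, ?_, fun _ => hc⟩
    · intros; omega
    · intros; omega
    · intros; omega
  · have hc : P.cross r z = false := by simpa using hc
    obtain ⟨x, h1, h2, h3, h4, h5, h6⟩ := P.follow r (N - (r + (z+1) + 1)) (z+1) (by omega)
    rw [P.west_succ_elbow hc] at h3 h4
    exact ⟨x, by omega, h2, h3, h4, h5, fun _ => h6, fun h => by omega⟩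

lemma exists_north (P : PipeDream N) : ∀ k r d : ℕ, r + k = d → d < N →
    ∃ x, r + x + 1 ≤ N ∧ P.north r x = d := by
  intro k
  induction k with
  | zero =>
    intro r d h hd
    obtain ⟨x, h1, h2, h3, -⟩ := P.follow r (N - (r + 0 + 1)) 0 (by omega)
    rw [west_zero] at h3
    exact ⟨x, h2, by omega⟩
  | succ k ih =>
    intro r d h hd
    obtain ⟨z, h1, h2⟩ := ih (r+1) d (by omega) hd
    obtain ⟨x, -, h4, h5, -⟩ := P.follow_south (r := r) (z := z) (by omega)
    exact ⟨x, h4, by rw [h5, P.south_eq (by omega), h2]⟩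

lemma north_surj (P : PipeDream N) {r d : ℕ} (h : r ≤ d) (hd : d < N) :
    ∃ x, r + x + 1 ≤ N ∧ P.north r x = d := P.exists_north (d - r) r d (by omega) hd

lemma image_north (P : PipeDream N) (r : ℕ) :
    (Finset.range (N - r)).image (P.north r) = Finset.Ico r N := by
  symm
  apply Finset.eq_of_subset_of_card_le
  · intro d hd
    rw [Finset.mem_Ico] at hd
    obtain ⟨x, h1, h2⟩ := P.north_surj hd.1 hd.2
    exact Finset.mem_image.2 ⟨x, Finset.mem_range.2 (by omega), h2⟩
  · refine Finset.card_image_le.trans ?_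
    simp

lemma north_mem (P : PipeDream N) {r x : ℕ} (h : r + x + 1 ≤ N) :
    r ≤ P.north r x ∧ P.north r x < N := by
  rw [← Finset.mem_Ico, ← P.image_north r]
  exact Finset.mem_image_of_mem _ (Finset.mem_range.2 (by omega))

lemma north_inj (P : PipeDream N) {r x y : ℕ} (hx : r + x + 1 ≤ N) (hy : r + y + 1 ≤ N)
    (h : P.north r x = P.north r y) : x = y := by
  have : Set.InjOn (P.north r) (Finset.range (N - r)) := by
    apply Finset.injOn_of_card_image_eq
    rw [image_north]; simp
  exact this (by simp; omega) (by simp; omega) h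

lemma south_mem (P : PipeDream N) {r x : ℕ} (h : r + x + 2 ≤ N) :
    r < P.south r x ∧ P.south r x < N := by
  rw [P.south_eq h]; exact P.north_mem (by omega)

lemma south_inj (P : PipeDream N) {r x y : ℕ} (hx : r + x + 2 ≤ N) (hy : r + y + 2 ≤ N)
    (h : P.south r x = P.south r y) : x = y := by
  rw [P.south_eq hx, P.south_eq hy] at h
  exact P.north_inj (by omega) (by omega) h

/-- the column at which pipe `d` leaves row `r` northwards -/
noncomputable def col (P : PipeDream N) (r d : ℕ) : ℕ :=
  if h : r ≤ d ∧ d < N then (P.north_surj h.1 h.2).choose else 0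

lemma col_shape (P : PipeDream N) {r d : ℕ} (h : r ≤ d) (hd : d < N) : r + P.col r d + 1 ≤ N := by
  unfold col; rw [dif_pos ⟨h, hd⟩]; exact (P.north_surj h hd).choose_spec.1

lemma north_col (P : PipeDream N) {r d : ℕ} (h : r ≤ d) (hd : d < N) :
    P.north r (P.col r d) = d := by
  unfold col; rw [dif_pos ⟨h, hd⟩]; exact (P.north_surj h hd).choose_spec.2

lemma col_eq (P : PipeDream N) {r x d : ℕ} (hx : r + x + 1 ≤ N) (h : P.north r x = d) :
    P.col r d = x := by
  have h1 := P.north_mem hx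
  rw [h] at h1
  exact P.north_inj (P.col_shape h1.1 h1.2) hx (by rw [P.north_col h1.1 h1.2, h])

lemma col_inj (P : PipeDream N) {r d d' : ℕ} (h : r ≤ d) (hd : d < N) (h' : r ≤ d') (hd' : d' < N)
    (e : P.col r d = P.col r d') : d = d' := by
  rw [← P.north_col h hd, e, P.north_col h' hd']

lemma col_eq_south (P : PipeDream N) {r x d : ℕ} (hx : r + x + 2 ≤ N) (h : P.south r x = d) :
    P.col (r+1) d = x := P.col_eq (by omega) (by rw [← P.south_eq hx, h])

lemma south_col (P : PipeDream N) {r d : ℕ} (h : r < d) (hd : d < N) :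
    P.south r (P.col (r+1) d) = d := by
  rw [P.south_eq (by have := P.col_shape (r := r+1) h hd; omega), P.north_col h hd]

/-- west values -/
lemma west_cases (P : PipeDream N) (r : ℕ) : ∀ x : ℕ, r + x + 1 ≤ N →
    (P.west r x = r ∧ ∀ v < x, P.cross r v = true) ∨
    (r < P.west r x ∧ P.west r x < N ∧ P.col (r+1) (P.west r x) < x) := by
  intro x
  induction x with
  | zero => intro _; left; exact ⟨P.west_zero r, by intros; omega⟩
  | succ x ih =>
    intro hx
    by_cases hc : P.cross r x = true
    · rw [P.west_succ_cross hc]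
      rcases ih (by omega) with h | h
      · left; refine ⟨h.1, fun v hv => ?_⟩
        rcases Nat.lt_succ_iff_lt_or_eq.1 hv with h' | h'
        · exact h.2 v h'
        · rw [h']; exact hc
      · right; omega
    · rw [P.west_succ_elbow (by simpa using hc)]
      right
      have := P.south_mem (r := r) (x := x) (by omega)
      refine ⟨this.1, this.2, ?_⟩
      rw [P.col_eq_south (r := r) (x := x) (by omega) rfl]; omega

lemma west_eq_of_cross (P : PipeDream N) (r : ℕ) : ∀ x : ℕ,
    (∀ v < x, P.cross r v = true) → P.west r x = r := by
  intro x
  induction x with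
  | zero => intro _; exact P.west_zero r
  | succ x ih =>
    intro h
    rw [P.west_succ_cross (h x (by omega))]
    exact ih (fun v hv => h v (by omega))

lemma col_mono_step (P : PipeDream N) {r d : ℕ} (h : r < d) (hd : d < N) :
    P.col (r+1) d ≤ P.col r d := by
  have hs := P.col_shape (r := r+1) h hd
  obtain ⟨x, h1, h2, h3, -⟩ := P.follow_south (r := r) (z := P.col (r+1) d) (by omega)
  rw [P.south_col h hd] at h3
  rw [P.col_eq h2 h3]; exact h1

lemma col_mono (P : PipeDream N) {d : ℕ} (hd : d < N) {r r' : ℕ} (hr : r ≤ r') (h : r' ≤ d) :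
    P.col r' d ≤ P.col r d := by
  induction r', hr using Nat.le_induction with
  | base => exact le_rfl
  | succ m hm ih => exact (P.col_mono_step (by omega) hd).trans (ih (by omega))

/-- Order of two pipes after a row. -/
lemma order_step (P : PipeDream N) {r c d : ℕ} (hc : r < c) (hcN : c < N) (hd : r < d) (hdN : d < N)
    (hlt : P.col (r+1) c < P.col (r+1) d) :
    P.col r d < P.col r c ↔
      P.cross r (P.col (r+1) d) = true ∧ P.west r (P.col (r+1) d) = c := by
  have hsc := P.col_shape (r := r+1) hc hcN
  have hsd := P.col_shape (r := r+1) hd hdN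
  obtain ⟨x, h1, h2, h3, h4, h5, h6, h7⟩ := P.follow_south (r := r) (z := P.col (r+1) c) (by omega)
  obtain ⟨y, g1, g2, g3, g4, g5, g6, g7⟩ := P.follow_south (r := r) (z := P.col (r+1) d) (by omega)
  rw [P.south_col hc hcN] at h3 h4
  rw [P.south_col hd hdN] at g3 g4
  rw [P.col_eq h2 h3, P.col_eq g2 g3]
  constructor
  · intro hyx
    exact ⟨h5 _ hlt (by omega), h4 _ hlt (by omega)⟩
  · rintro ⟨k1, k2⟩
    have hy : y = P.col (r+1) d := by
      have : P.north r (P.col (r+1) d) = d := by rw [P.north_cross k1, P.south_col hd hdN]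
      rw [← P.col_eq g2 g3, P.col_eq (by omega) this]
    by_contra hxy
    have hne : x ≠ y := by
      rintro rfl
      have := h3.symm.trans g3
      subst this; omega
    -- c at west of box w > x : contradiction
    rcases P.west_cases r (P.col (r+1) d) (by omega) with h | h
    · omega
    · have hxw : x < P.col (r+1) d := by omega
      have : P.col r c = P.col r c := rfl
      -- after exit at x the pipe cannot be horizontal later
      obtain ⟨x', e1, e2, e3, -⟩ := P.follow r (N - (r + P.col (r+1) d + 1)) (P.col (r+1) d) (by omega)
      rw [k2] at e3
      have := P.north_inj h2 e2 (h3.trans e3.symm)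
      omega

/-- `X`-lemma. -/
lemma swapped_iff (P : PipeDream N) (hR : P.Reduced) {c d : ℕ} (hcd : c < d) (hd : d < N) :
    ∀ k r : ℕ, r + k = c → (P.col r d < P.col r c ↔
      ∃ s z, r ≤ s ∧ s ≤ c ∧ P.cross s z = true ∧ P.west s z = c ∧ P.south s z = d) := by
  intro k
  induction k with
  | zero =>
    intro r hr
    obtain rfl : r = c := by omega
    obtain ⟨x, h1, h2, h3, h4, h5, h6⟩ := P.follow r (N - (r + 0 + 1)) 0 (by omega)
    rw [west_zero] at h3 h4
    have hsd := P.col_shape (r := r+1) hcd hd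
    obtain ⟨y, g1, g2, g3, g4, g5, g6, g7⟩ := P.follow_south (r := r) (z := P.col (r+1) d) (by omega)
    rw [P.south_col hcd hd] at g3 g4
    rw [P.col_eq h2 h3, P.col_eq g2 g3]
    constructor
    · intro hyx
      exact ⟨r, _, le_rfl, le_rfl, h5 _ (by omega) (by omega), h4 _ (by omega) (by omega),
        P.south_col hcd hd⟩
    · rintro ⟨s, z, k1, k2, k3, k4, k5⟩
      obtain rfl : s = r := by omega
      have hsh := P.inShape _ _ k3
      have hz := P.col_eq_south hsh k5
      have hy := P.col_eq (r := s) (x := z) (by omega) ((P.north_cross k3).trans k5)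
      rw [P.col_eq g2 g3] at hy
      rcases P.west_cases s z (by omega) with h | h
      · by_contra hh
        have : x ≠ z := by rintro rfl; rw [h6] at k3; cases k3
        have := h.2 x (by omega)
        rw [h6] at this; cases this
      · omega
  | succ k ih =>
    intro r hr
    have ih := ih (r+1) (by omega)
    have hne : P.col (r+1) c ≠ P.col (r+1) d := fun h => by
      have := P.col_inj (r := r+1) (by omega) (by omega) (by omega) hd h
      omega
    by_cases hlt : P.col (r+1) d < P.col (r+1) c
    · obtain ⟨s, z, k1, k2, k3, k4, k5⟩ := ih.1 hlt
      have hst := P.order_step (r := r) (c := d) (d := c) (by omega) hd (by omega) (by omega) hlt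
      have hne' : P.col r c ≠ P.col r d := fun h => by
        have := P.col_inj (r := r) (by omega) (by omega) (by omega) hd h
        omega
      refine ⟨fun _ => ⟨s, z, by omega, k2, k3, k4, k5⟩, fun _ => ?_⟩
      by_contra hcon
      obtain ⟨e1, e2⟩ := hst.1 (by omega)
      refine hR s z r _ k3 e1 ?_ (Or.inr ⟨?_, ?_⟩)
      · intro h; rw [Prod.mk.injEq] at h; omega
      · rw [k4, P.south_col (by omega) (by omega)]
      · rw [k5, e2]
    · have hst := P.order_step (r := r) (c := c) (d := d) (by omega) (by omega) (by omega) hd (by omega)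
      rw [hst]
      constructor
      · rintro ⟨e1, e2⟩
        exact ⟨r, _, le_rfl, by omega, e1, e2, P.south_col (by omega) hd⟩
      · rintro ⟨s, z, k1, k2, k3, k4, k5⟩
        rcases Nat.eq_or_lt_of_le k1 with h | h
        · subst h
          rw [P.col_eq_south (P.inShape _ _ k3) k5]
          exact ⟨k3, k4⟩
        · exact absurd (ih.2 ⟨s, z, h, k2, k3, k4, k5⟩) hlt

lemma swapped (P : PipeDream N) (hR : P.Reduced) {c d r : ℕ} (hcd : c < d) (hd : d < N) (hr : r ≤ c) :
    P.col r d < P.col r c ↔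
      ∃ s z, r ≤ s ∧ s ≤ c ∧ P.cross s z = true ∧ P.west s z = c ∧ P.south s z = d :=
  P.swapped_iff hR hcd hd (c - r) r (by omega)

/-- A crossing in which the larger pipe crosses below... data of a crossing. -/
lemma row_le_west (P : PipeDream N) {s z : ℕ} (h : P.cross s z = true) : s ≤ P.west s z := by
  have := P.inShape _ _ h
  rcases P.west_cases s z (by omega) with h | h <;> omega

/-- Avoidance of `132` by positive pipes. -/
def Dom (P : PipeDream N) : Prop := ∀ h c d : ℕ, 1 ≤ h → h < c → c < d → d < N →
  P.col 0 h < P.col 0 d → P.col 0 d < P.col 0 c → False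

/-- crossings sit in the first row of the smaller pipe or the last column of the larger one -/
lemma cross_pos (P : PipeDream N) (hR : P.Reduced) (hD : P.Dom) {c d s z : ℕ} (hc : 1 ≤ c)
    (hcd : c < d) (hd : d < N) (hX : P.cross s z = true) (hw : P.west s z = c)
    (hs : P.south s z = d) : s = c ∨ z = P.col 0 d := by
  by_contra hcon
  push Not at hcon
  have hsc : s ≤ c := by rw [← hw]; exact P.row_le_west hX
  have hsh := P.inShape _ _ hX
  have hpos : P.col 0 d < P.col 0 c :=
    (P.swapped hR hcd hd (Nat.zero_le _)).2 ⟨s, z, Nat.zero_le _, hsc, hX, hw, hs⟩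
  have hzd : P.col (s+1) d = z := P.col_eq_south hsh hs
  have hzq : z < P.col 0 d := by
    have := P.col_mono hd (r := 0) (r' := s+1) (by omega) (by omega)
    omega
  have hdc : P.col c d < P.col 0 d := by
    have := P.col_mono hd (r := s+1) (r' := c) (by omega) (by omega)
    omega
  have hcc : P.col c c < P.col 0 d := by
    have h1 := P.col_mono (d := c) (by omega) (r := s+1) (r' := c) (by omega) (by omega)
    rcases P.west_cases s z (by omega) with h | h
    · omega
    · rw [hw] at h; omega
  -- pigeonhole
  set q := P.col 0 d with hq
  let A : Finset ℕ := insert c (insert d (((Finset.range q).erase (P.col 0 0)).image (P.north 0)))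
  have hqN := P.col_shape (r := 0) (d := d) (Nat.zero_le _) hd
  have hcol : ∀ x, x < q → P.col 0 (P.north 0 x) = x := fun x hx => P.col_eq (by omega) rfl
  have hdn : d ∉ ((Finset.range q).erase (P.col 0 0)).image (P.north 0) := by
    simp only [Finset.mem_image, Finset.mem_erase, Finset.mem_range]
    rintro ⟨x, ⟨-, hx⟩, rfl⟩
    rw [hcol x hx] at hq; omega
  have hcn : c ∉ insert d (((Finset.range q).erase (P.col 0 0)).image (P.north 0)) := by
    simp only [Finset.mem_insert, Finset.mem_image, Finset.mem_erase, Finset.mem_range]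
    rintro (h | ⟨x, ⟨-, hx⟩, h⟩)
    · omega
    · have := hcol x hx
      rw [h] at this; omega
  have hA : q + 1 ≤ A.card := by
    rw [Finset.card_insert_of_notMem hcn, Finset.card_insert_of_notMem hdn,
      Finset.card_image_of_injOn]
    · have := Finset.pred_card_le_card_erase (s := Finset.range q) (a := P.col 0 0)
      rw [Finset.card_range] at this; omega
    · intro x hx y hy hxy
      simp only [Finset.coe_erase, Set.mem_sdiff, Finset.mem_coe, Finset.mem_range] at hx hy
      rw [← hcol x hx.1, ← hcol y hy.1]; exact congrArg _ hxy
  have hmem : ∀ l ∈ A, c ≤ l ∧ l < N ∧ P.col c l < q := by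
    intro l hl
    simp only [A, Finset.mem_insert, Finset.mem_image, Finset.mem_erase, Finset.mem_range] at hl
    rcases hl with rfl | rfl | ⟨x, ⟨hx0, hx⟩, rfl⟩
    · exact ⟨le_rfl, by omega, hcc⟩
    · exact ⟨by omega, hd, hdc⟩
    · have hm := P.north_mem (r := 0) (x := x) (by omega)
      have hcx := hcol x hx
      have hge : c ≤ P.north 0 x := by
        by_contra hlt
        by_cases h0 : P.north 0 x = 0
        · rw [h0] at hcx; omega
        · exact hD (P.north 0 x) c d (by omega) (by omega) hcd hd (by omega) hpos
      refine ⟨hge, hm.2, ?_⟩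
      have := P.col_mono hm.2 (Nat.zero_le c) hge
      omega
  obtain ⟨x, hx, y, hy, hxy, he⟩ := Finset.exists_ne_map_eq_of_card_lt_of_maps_to
    (s := A) (t := Finset.range q) (f := P.col c) (by rw [Finset.card_range]; omega)
    (fun l hl => by simpa using (hmem l hl).2.2)
  exact hxy (P.col_inj (hmem x hx).1 (hmem x hx).2.1 (hmem y hy).1 (hmem y hy).2.1 he)

/-- The auxiliary relation containing the contact arcs. -/
def Rel (P : PipeDream N) (i j : ℕ) : Prop := 1 ≤ i ∧ 1 ≤ j ∧ i < N ∧ j < N ∧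
  ((i < j ∧ ¬ ∃ z, P.cross i z = true ∧ P.west i z = i ∧ P.south i z = j) ∨
   (j < i ∧ ∃ z, z ≠ P.col 0 i ∧ P.cross j z = true ∧ P.west j z = j ∧ P.south j z = i))

lemma rel_trans_min (P : PipeDream N) (hR : P.Reduced) (hD : P.Dom) {a c d : ℕ} (hac : a < c)
    (had : a < d) (h1 : P.Rel c a) (h2 : P.Rel a d) : P.Rel c d := by
  obtain ⟨c1, a1, cN, aN, h⟩ := h1
  obtain ⟨-, d1, -, dN, h'⟩ := h2
  rcases h with ⟨h, -⟩ | ⟨-, y, hy, hX, hw, hs⟩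
  · omega
  rcases h' with ⟨-, hno⟩ | ⟨h, -⟩
  swap
  · omega
  have hsh := P.inShape _ _ hX
  have hcy : P.col (a+1) c = y := P.col_eq_south hsh hs
  have hcross : ∀ v < y, P.cross a v = true := by
    rcases P.west_cases a y (by omega) with h | h
    · exact h.2
    · omega
  have hne : c ≠ d := by
    rintro rfl; exact hno ⟨y, hX, hw, hs⟩
  have hdy : ¬ P.col (a+1) d < P.col (a+1) c := by
    intro hlt
    refine hno ⟨P.col (a+1) d, hcross _ (by omega), ?_, P.south_col had dN⟩
    exact P.west_eq_of_cross a _ (fun v hv => hcross v (by omega))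
  have hne2 : P.col (a+1) d ≠ P.col (a+1) c := fun h =>
    hne (P.col_inj (by omega) dN (by omega) cN h).symm
  refine ⟨c1, d1, cN, dN, ?_⟩
  rcases Nat.lt_or_gt_of_ne hne with hcd | hcd
  · left
    refine ⟨hcd, ?_⟩
    rintro ⟨z, k1, k2, k3⟩
    exact hdy ((P.swapped hR hcd dN (by omega)).2 ⟨c, z, by omega, le_rfl, k1, k2, k3⟩)
  · right
    refine ⟨hcd, ?_⟩
    obtain ⟨s, z, k1, k2, k3, k4, k5⟩ :=
      (P.swapped hR hcd cN (r := a+1) (by omega)).1 (by omega)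
    have hz := P.col_eq_south (P.inShape _ _ k3) k5
    have m1 := P.col_mono cN (r := a+1) (r' := s+1) (by omega) (by omega)
    have m2 := P.col_mono cN (r := 0) (r' := a+1) (by omega) (by omega)
    have hzne : z ≠ P.col 0 c := by omega
    rcases P.cross_pos hR hD d1 hcd cN k3 k4 k5 with h | h
    · subst h; exact ⟨z, hzne, k3, k4, k5⟩
    · omega

lemma arc_rel (P : PipeDream N) (hR : P.Reduced) (hD : P.Dom) {i j : ℕ} (hi : 1 ≤ i)
    (h : P.Arc i j) : P.Rel i j := by
  obtain ⟨r, x, hsh, hX, hw, hs⟩ := h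
  have hj := P.south_mem hsh
  rw [hs] at hj
  have hjx := P.col_eq_south hsh hs
  have hw' := P.west_cases r x (by omega)
  rw [hw] at hw'
  rcases hw' with ⟨h1, h2⟩ | ⟨h1, h2, h3⟩
  · subst h1
    refine ⟨hi, by omega, by omega, hj.2, Or.inl ⟨hj.1, ?_⟩⟩
    rintro ⟨z, k1, k2, k3⟩
    have := P.south_inj hsh (P.inShape _ _ k1) (hs.trans k3.symm)
    subst this
    rw [hX] at k1; cases k1
  · refine ⟨hi, by omega, h2, hj.2, ?_⟩
    have hne : i ≠ j := by rintro rfl; omega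
    rcases Nat.lt_or_gt_of_ne hne with hij | hij
    · left
      refine ⟨hij, ?_⟩
      rintro ⟨z, k1, k2, k3⟩
      have := (P.swapped hR hij hj.2 (r := r+1) (by omega)).2 ⟨i, z, by omega, le_rfl, k1, k2, k3⟩
      omega
    · right
      refine ⟨hij, ?_⟩
      obtain ⟨s, z, k1, k2, k3, k4, k5⟩ :=
        (P.swapped hR hij h2 (r := r+1) (by omega)).1 (by omega)
      have hz := P.col_eq_south (P.inShape _ _ k3) k5
      have m1 := P.col_mono h2 (r := r+1) (r' := s+1) (by omega) (by omega)
      have m2 := P.col_mono h2 (r := 0) (r' := r) (by omega) (by omega)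
      have hx : P.col r i = x := P.col_eq (by omega) ((P.north_elbow hX).trans hw)
      have hzne : z ≠ P.col 0 i := by omega
      rcases P.cross_pos hR hD (by omega) hij h2 k3 k4 k5 with h | h
      · subst h; exact ⟨z, hzne, k3, k4, k5⟩
      · omega

end PipeDream

/-- elimination of minimal vertices -/
lemma acyclic_of_min_trans (R : ℕ → ℕ → Prop) (N : ℕ) (hN : ∀ i j, R i j → j < N)
    (hirr : ∀ i, ¬ R i i) (hT : ∀ a c d, a < c → a < d → R c a → R a d → R c d) :
    ∀ i, ¬ Relation.TransGen R i i := by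
  have key : ∀ m x y, m < x → Relation.TransGen (fun i j => R i j ∧ m ≤ i ∧ m ≤ j) x y →
      (m < y ∧ Relation.TransGen (fun i j => R i j ∧ m+1 ≤ i ∧ m+1 ≤ j) x y) ∨
      (y = m ∧ ∃ z, m < z ∧
        Relation.ReflTransGen (fun i j => R i j ∧ m+1 ≤ i ∧ m+1 ≤ j) x z ∧ R z m) := by
    intro m x y hx h
    induction h with
    | single h =>
      rename_i y
      rcases Nat.eq_or_lt_of_le h.2.2 with e | e
      · right; exact ⟨e.symm, x, hx, .refl, e ▸ h.1⟩
      · left; exact ⟨e, .single ⟨h.1, hx, e⟩⟩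
    | tail h1 h ih =>
      rename_i y w
      rcases ih with ⟨hy, ih⟩ | ⟨hy, z, hz, ih, hzm⟩
      · rcases Nat.eq_or_lt_of_le h.2.2 with e | e
        · right; exact ⟨e.symm, y, hy, ih.to_reflTransGen, e ▸ h.1⟩
        · left; exact ⟨e, ih.tail ⟨h.1, hy, e⟩⟩
      · subst hy
        rcases Nat.eq_or_lt_of_le h.2.2 with e | e
        · exact absurd (e ▸ h.1) (hirr y)
        · left
          exact ⟨e, .tail' ih ⟨hT y z w hz e hzm h.1, hz, e⟩⟩
  have step : ∀ m, (∃ x, Relation.TransGen (fun i j => R i j ∧ m ≤ i ∧ m ≤ j) x x) →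
      ∃ x, Relation.TransGen (fun i j => R i j ∧ m+1 ≤ i ∧ m+1 ≤ j) x x := by
    rintro m ⟨x, h⟩
    have main : ∀ x, m < x → Relation.TransGen (fun i j => R i j ∧ m ≤ i ∧ m ≤ j) x x →
        ∃ x, Relation.TransGen (fun i j => R i j ∧ m+1 ≤ i ∧ m+1 ≤ j) x x := by
      intro x hx h
      rcases key m x x hx h with h | h
      · exact ⟨x, h.2⟩
      · omega
    have hxm : m ≤ x := by
      obtain ⟨z, -, hz⟩ := Relation.TransGen.tail'_iff.1 h
      exact hz.2.2
    rcases Nat.eq_or_lt_of_le hxm with e | e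
    · subst e
      obtain ⟨z, hz1, hz2⟩ := Relation.TransGen.tail'_iff.1 h
      have hzne : z ≠ m := by rintro rfl; exact hirr _ hz2.1
      refine main z (by omega) ?_
      exact Relation.TransGen.head' hz2 hz1
    · exact main x e h
  intro i hi
  have all : ∀ m, ∃ x, Relation.TransGen (fun i j => R i j ∧ m ≤ i ∧ m ≤ j) x x := by
    intro m
    induction m with
    | zero => exact ⟨i, Relation.TransGen.mono (r := R) (fun a b h => ⟨h, Nat.zero_le _, Nat.zero_le _⟩) i i hi⟩
    | succ m ih => exact step m ih
  obtain ⟨x, hx⟩ := all N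
  obtain ⟨z, -, hz⟩ := Relation.TransGen.tail'_iff.1 hx
  have := hN _ _ hz.1
  omega

namespace PipeDream
variable {N : ℕ}

lemma acyclic_of_dom (P : PipeDream N) (hR : P.Reduced) (hD : P.Dom) : P.Acyclic := by
  intro i hi
  have h1 : ∀ {a b}, P.Arc a b → 1 ≤ b := by
    rintro a b ⟨r, x, hsh, -, -, hs⟩
    have := P.south_mem hsh
    omega
  have hi1 : 1 ≤ i := by
    obtain ⟨z, -, hz⟩ := Relation.TransGen.tail'_iff.1 hi
    exact h1 hz
  have : Relation.TransGen P.Rel i i := by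
    have aux : ∀ y, Relation.TransGen P.Arc i y → 1 ≤ y ∧ Relation.TransGen P.Rel i y := by
      intro y hy
      induction hy with
      | single h => exact ⟨h1 h, .single (P.arc_rel hR hD hi1 h)⟩
      | tail _ h ih => exact ⟨h1 h, ih.2.tail (P.arc_rel hR hD ih.1 h)⟩
    exact (aux i hi).2
  refine acyclic_of_min_trans P.Rel N (fun i j h => h.2.2.2.1) ?_ ?_ i this
  · rintro i ⟨-, -, -, -, h | h⟩ <;> omega
  · intro a c d h1 h2 h3 h4
    exact P.rel_trans_min hR hD h1 h2 h3 h4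

end PipeDream

/-- number of pipes `≥ r` exiting to the left of pipe `l` -/
def dnum (N : ℕ) (pos : ℕ → ℕ) (r l : ℕ) : ℕ :=
  ((Finset.Ico r N).filter (fun m => pos m < pos l)).card

section dnum
variable {N : ℕ} {pos : ℕ → ℕ}

lemma dnum_succ {r l : ℕ} (hr : r < N) :
    dnum N pos r l = dnum N pos (r+1) l + if pos r < pos l then 1 else 0 := by
  unfold dnum
  rw [← Finset.insert_Ico_add_one_left_eq_Ico hr, Finset.filter_insert]
  split_ifs with h
  · rw [Finset.card_insert_of_notMem (by simp)]
  · rfl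

lemma dnum_mono {r l l' : ℕ} (h : pos l ≤ pos l') : dnum N pos r l ≤ dnum N pos r l' := by
  apply Finset.card_le_card
  intro m hm
  simp only [Finset.mem_filter] at hm ⊢
  exact ⟨hm.1, by omega⟩

lemma dnum_lt {r l l' : ℕ} (hl : r ≤ l) (hlN : l < N) (h : pos l < pos l') :
    dnum N pos r l < dnum N pos r l' := by
  apply Finset.card_lt_card
  rw [Finset.ssubset_iff_of_subset]
  · exact ⟨l, by simp; omega, by simp⟩
  · intro m hm
    simp only [Finset.mem_filter] at hm ⊢
    exact ⟨hm.1, by omega⟩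

lemma dnum_le {r l : ℕ} : dnum N pos r l ≤ N - r := by
  unfold dnum
  refine (Finset.card_filter_le _ _).trans ?_
  simp

lemma dnum_lt_of_mem {r l : ℕ} (hl : r ≤ l) (hlN : l < N) : r + dnum N pos r l + 1 ≤ N := by
  have : dnum N pos r l < (Finset.Ico r N).card := by
    apply Finset.card_lt_card
    rw [Finset.ssubset_iff_of_subset (Finset.filter_subset _ _)]
    exact ⟨l, by simp; omega, by simp⟩
  rw [Nat.card_Ico] at this; omega

lemma dnum_zero (hb : Set.BijOn pos (Set.Iio N) (Set.Iio N)) {l : ℕ} (hl : l < N) :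
    dnum N pos 0 l = pos l := by
  have h1 : ((Finset.Ico 0 N).filter (fun m => pos m < pos l)).image pos
      = Finset.range (pos l) := by
    ext x
    simp only [Finset.mem_image, Finset.mem_filter, Finset.mem_Ico, Finset.mem_range]
    constructor
    · rintro ⟨m, ⟨-, h⟩, rfl⟩; exact h
    · intro hx
      have hpl : pos l < N := hb.mapsTo hl
      obtain ⟨m, hm, rfl⟩ := hb.surjOn (show x ∈ Set.Iio N from by simp; omega)
      exact ⟨m, ⟨⟨Nat.zero_le _, hm⟩, hx⟩, rfl⟩
  unfold dnum
  have h2 := congrArg Finset.card h1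
  rw [Finset.card_range, Finset.card_image_of_injOn] at h2
  · exact h2
  intro x hx y hy hxy
  simp at hx hy
  exact hb.injOn (show x < N by omega) (show y < N by omega) hxy

end dnum

/-- the crossings of the special pipe dream -/
def spCross (N : ℕ) (pos : ℕ → ℕ) (i r c : ℕ) : Prop :=
  if r = i + 1 then c + 1 < dnum N pos (r+1) r
  else if r = i then c < dnum N pos (r+1) r ∨ c = dnum N pos (i+2) (i+1)
  else c < dnum N pos (r+1) r

/-- Data of the pattern. -/
structure SpData (N : ℕ) (pos : ℕ → ℕ) (i k : ℕ) : Prop where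
  bij : Set.BijOn pos (Set.Iio N) (Set.Iio N)
  zero : pos 0 = 0
  hi : 1 ≤ i
  hk : i + 2 ≤ k
  hkN : k < N
  ik : pos i < pos k
  kj : pos k < pos (i+1)
  max : ∀ m, i + 2 ≤ m → m < N → pos m < pos (i+1) → pos m ≤ pos k

namespace SpData
variable {N : ℕ} {pos : ℕ → ℕ} {i k : ℕ}

open Classical in
/-- the special pipe dream -/
noncomputable def dream (h : SpData N pos i k) : PipeDream N where
  cross r c := decide (spCross N pos i r c)
  inShape r c hc := by
    have hc := of_decide_eq_true hc
    unfold spCross at hc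
    have h1 := dnum_le (N := N) (pos := pos) (r := r+1) (l := r)
    have h2 := dnum_le (N := N) (pos := pos) (r := i+2) (l := i+1)
    have := h.hk
    have := h.hkN
    split_ifs at hc <;> omega

variable (h : SpData N pos i k)

lemma pos_ne (h : SpData N pos i k) {l m : ℕ} (hl : l < N) (hm : m < N) (hne : l ≠ m) : pos l ≠ pos m :=
  fun e => hne (h.bij.injOn hl hm e)

lemma cross_iff (r c : ℕ) : h.dream.cross r c = true ↔ spCross N pos i r c := by
  simp [dream]

lemma cross_false_iff (r c : ℕ) : h.dream.cross r c = false ↔ ¬ spCross N pos i r c := by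
  simp [dream]

lemma cross_normal {r c : ℕ} (h1 : r ≠ i) (h2 : r ≠ i+1) :
    h.dream.cross r c = true ↔ c < dnum N pos (r+1) r := by
  rw [cross_iff]; unfold spCross; simp [h1, h2]

lemma b_eq (h : SpData N pos i k) : dnum N pos (i+2) (i+1) = dnum N pos (i+2) k + 1 := by
  unfold dnum
  rw [← Finset.card_insert_of_notMem (a := k)]
  swap
  · simp
  congr 1
  ext m
  have := h.kj
  have := h.hk
  have := h.hkN
  simp only [Finset.mem_filter, Finset.mem_Ico, Finset.mem_insert]
  constructor
  · rintro ⟨hm, hlt⟩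
    by_cases e : m = k
    · exact Or.inl e
    · have := h.max m hm.1 hm.2 hlt
      have := h.pos_ne hm.2 h.hkN e
      right; exact ⟨hm, by omega⟩
  · rintro (rfl | ⟨hm, hlt⟩)
    · exact ⟨by omega, by omega⟩
    · exact ⟨hm, by omega⟩

lemma row_normal {r : ℕ} (hr : r < N) (h1 : r ≠ i) (h2 : r ≠ i+1)
    (ih : ∀ l, r < l → l < N → h.dream.north (r+1) (dnum N pos (r+1) l) = l) :
    ∀ l, r ≤ l → l < N → h.dream.north r (dnum N pos r l) = l := by
  intro l hl hlN
  have hd := dnum_succ (N := N) (pos := pos) (r := r) (l := l) hr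
  have hcr : ∀ c, h.dream.cross r c = true ↔ c < dnum N pos (r+1) r :=
    fun c => h.cross_normal h1 h2
  have hcf : ∀ c, dnum N pos (r+1) r ≤ c → h.dream.cross r c = false := by
    intro c hc
    have := hcr c
    by_contra hh
    simp at hh
    rw [hh] at this; simp at this; omega
  rcases Nat.eq_or_lt_of_le hl with rfl | hl'
  · simp at hd
    rw [hd, h.dream.north_elbow (hcf _ le_rfl)]
    exact h.dream.west_eq_of_cross _ _ (fun v hv => (hcr v).2 hv)
  · have hs : h.dream.south r (dnum N pos (r+1) l) = l := by
      rw [h.dream.south_eq (by have := dnum_lt_of_mem (pos := pos) (r := r+1) hl' hlN; omega)]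
      exact ih l hl' hlN
    have hne := h.pos_ne hr hlN (by omega)
    by_cases hp : pos r < pos l
    · rw [if_pos hp] at hd
      have hm := dnum_mono (N := N) (pos := pos) (r := r+1) hp.le
      rw [hd, h.dream.north_elbow (hcf _ (by omega)), h.dream.west_succ_elbow (hcf _ hm), hs]
    · rw [if_neg hp] at hd
      have hm := dnum_lt (N := N) (pos := pos) (r := r+1) (l := l) (l' := r) hl' hlN (by omega)
      rw [hd, Nat.add_zero, h.dream.north_cross ((hcr _).2 hm), hs]

lemma rows_high : ∀ t r : ℕ, r + t = N → i + 2 ≤ r →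
    ∀ l, r ≤ l → l < N → h.dream.north r (dnum N pos r l) = l := by
  intro t
  induction t with
  | zero => intro r hr _ l h1 h2; omega
  | succ t ih =>
    intro r hr hi
    exact h.row_normal (by omega) (by omega) (by omega) (fun l h1 h2 => ih (r+1) (by omega) (by omega) l h1 h2)

lemma south_high {l : ℕ} (hl : i + 2 ≤ l) (hlN : l < N) :
    h.dream.south (i+1) (dnum N pos (i+2) l) = l := by
  have hs := dnum_lt_of_mem (pos := pos) (r := i+2) hl hlN
  rw [h.dream.south_eq (by omega)]
  exact h.rows_high (N - (i+2)) (i+2) (by omega) le_rfl l hl hlN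

lemma cross_row1 (c : ℕ) : h.dream.cross (i+1) c = decide (c < dnum N pos (i+2) k) := by
  have hb := h.b_eq
  rw [Bool.eq_iff_iff, cross_iff]; unfold spCross
  simp only [show i+1+1 = i+2 from rfl, if_true, decide_eq_true_eq]; omega

lemma cross_row0 (c : ℕ) : h.dream.cross i c =
    decide (c < dnum N pos (i+1) i ∨ c = dnum N pos (i+2) k + 1) := by
  have hb := h.b_eq
  rw [Bool.eq_iff_iff, cross_iff]; unfold spCross
  simp [hb]

/-- west value in row `i+1` -/
lemma west_row1 : h.dream.west (i+1) (dnum N pos (i+2) k) = i + 1 :=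
  h.dream.west_eq_of_cross _ _ (fun v hv => by rw [cross_row1]; simpa using hv)

lemma row1_j : h.dream.north (i+1) (dnum N pos (i+2) k) = i + 1 := by
  rw [h.dream.north_elbow (by rw [cross_row1]; simp), h.west_row1]

lemma row1_k : h.dream.north (i+1) (dnum N pos (i+2) k + 1) = k := by
  rw [h.dream.north_elbow (by rw [cross_row1]; simp),
    h.dream.west_succ_elbow (by rw [cross_row1]; simp), h.south_high h.hk h.hkN]

lemma row1_other {l : ℕ} (hl : i + 2 ≤ l) (hlN : l < N) (hlk : l ≠ k) :
    h.dream.north (i+1) (dnum N pos (i+1) l) = l := by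
  have hN := h.hkN
  have hk := h.hk
  have hb := h.b_eq
  have hd : dnum N pos (i+1) l = dnum N pos (i+2) l + if pos (i+1) < pos l then 1 else 0 :=
    dnum_succ (by omega)
  have hne := h.pos_ne hlN h.hkN hlk
  have hne' := h.pos_ne (l := l) (m := i+1) hlN (by omega) (by omega)
  by_cases hp : pos (i+1) < pos l
  · have hm := dnum_mono (N := N) (pos := pos) (r := i+2) hp.le
    rw [if_pos hp] at hd
    rw [hd, h.dream.north_elbow (by rw [cross_row1]; simp; omega),
      h.dream.west_succ_elbow (by rw [cross_row1]; simp; omega)]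
    exact h.south_high hl hlN
  · have := h.max l hl hlN (by omega)
    have hm := dnum_lt (N := N) (pos := pos) (r := i+2) (l := l) (l' := k) hl hlN (by omega)
    rw [if_neg hp] at hd
    rw [hd, Nat.add_zero, h.dream.north_cross (by rw [cross_row1]; simpa using hm)]
    exact h.south_high hl hlN

lemma a_le (h : SpData N pos i k) : dnum N pos (i+1) i ≤ dnum N pos (i+2) k := by
  have hd : dnum N pos (i+1) k = dnum N pos (i+2) k + if pos (i+1) < pos k then 1 else 0 :=
    dnum_succ (by have := h.hk; have := h.hkN; omega)
  have := h.kj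
  rw [if_neg (by omega)] at hd
  have := dnum_mono (N := N) (pos := pos) (r := i+1) h.ik.le
  omega

lemma shape_k (h : SpData N pos i k) : i + 2 + dnum N pos (i+2) k + 1 ≤ N := dnum_lt_of_mem h.hk h.hkN

lemma west_sp : h.dream.west i (dnum N pos (i+2) k + 1) = i + 1 := by
  have := h.a_le
  have := h.shape_k
  rw [h.dream.west_succ_elbow (by rw [cross_row0]; simp; omega), h.dream.south_eq (by omega), h.row1_j]

lemma south_sp : h.dream.south i (dnum N pos (i+2) k + 1) = k := by
  have := h.shape_k
  rw [h.dream.south_eq (by omega), h.row1_k]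

lemma row0 : ∀ l, i ≤ l → l < N → h.dream.north i (dnum N pos i l) = l := by
  intro l hl hlN
  have hN := h.hkN
  have hk := h.hk
  have hik := h.ik
  have hkj := h.kj
  have hb := h.b_eq
  have ha := h.a_le
  have hsh := h.shape_k
  have hd := dnum_succ (N := N) (pos := pos) (r := i) (l := l) (by omega)
  have hd' : dnum N pos (i+1) l = dnum N pos (i+2) l + if pos (i+1) < pos l then 1 else 0 :=
    dnum_succ (by omega)
  by_cases e1 : l = i
  · subst e1
    simp only [lt_irrefl, if_false, Nat.add_zero] at hd
    rw [hd, h.dream.north_elbow (by rw [cross_row0]; simp; omega)]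
    exact h.dream.west_eq_of_cross _ _ (fun v hv => by rw [cross_row0]; simp; omega)
  by_cases e2 : l = k
  · subst e2
    rw [if_pos hik] at hd
    rw [if_neg (by omega), Nat.add_zero] at hd'
    rw [hd, hd', h.dream.north_cross (by rw [cross_row0]; simp), h.south_sp]
  by_cases e3 : l = i + 1
  · subst e3
    rw [if_pos (by omega)] at hd
    rw [if_neg (by omega)] at hd'
    rw [hd, hd', Nat.add_zero, hb, h.dream.north_elbow (by rw [cross_row0]; simp; omega),
      h.dream.west_succ_cross (by rw [cross_row0]; simp), h.west_sp]
  have hs : h.dream.south i (dnum N pos (i+1) l) = l := by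
    rw [h.dream.south_eq (by have := dnum_lt_of_mem (pos := pos) (r := i+1) (l := l) (by omega) hlN; omega)]
    exact h.row1_other (by omega) hlN e2
  have n1 := h.pos_ne hlN (show i < N by omega) e1
  have n2 := h.pos_ne hlN h.hkN e2
  have n3 := h.pos_ne hlN (show i+1 < N by omega) e3
  by_cases hp : pos i < pos l
  · rw [if_pos hp] at hd
    have m1 := dnum_mono (N := N) (pos := pos) (r := i+1) hp.le
    have key : dnum N pos (i+1) l ≠ dnum N pos (i+2) k + 1 ∧
        dnum N pos (i+1) l ≠ dnum N pos (i+2) k := by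
      by_cases hq : pos (i+1) < pos l
      · rw [if_pos hq] at hd'
        have := dnum_mono (N := N) (pos := pos) (r := i+2) hq.le
        omega
      · rw [if_neg hq] at hd'
        have := h.max l (by omega) hlN (by omega)
        have := dnum_lt (N := N) (pos := pos) (r := i+2) (l := l) (l' := k) (by omega) hlN (by omega)
        omega
    rw [hd, h.dream.north_elbow (by rw [cross_row0]; simp; omega),
      h.dream.west_succ_elbow (by rw [cross_row0]; simp; omega), hs]
  · rw [if_neg hp] at hd
    have m1 := dnum_lt (N := N) (pos := pos) (r := i+1) (l := l) (l' := i) (by omega) hlN (by omega)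
    rw [hd, Nat.add_zero, h.dream.north_cross (by rw [cross_row0]; simp; omega), hs]

lemma rows_low : ∀ t r : ℕ, r + t = i →
    ∀ l, r ≤ l → l < N → h.dream.north r (dnum N pos r l) = l := by
  intro t
  induction t with
  | zero => intro r hr; obtain rfl : r = i := by omega
            exact h.row0
  | succ t ih =>
    intro r hr
    have := h.hk; have := h.hkN
    exact h.row_normal (by omega) (by omega) (by omega) (fun l h1 h2 => ih (r+1) (by omega) l h1 h2)

lemma exit {l : ℕ} (hl : l < N) : h.dream.north 0 (pos l) = l := by
  have := h.rows_low i 0 (by omega) l (Nat.zero_le _) hl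
  rwa [dnum_zero h.bij hl] at this

lemma cross_cases {r c : ℕ} (hc : h.dream.cross r c = true) :
    h.dream.west r c = r ∧ ¬ (r = i + 1 ∧ h.dream.south r c = k) ∨
      (r = i ∧ c = dnum N pos (i+2) k + 1 ∧ h.dream.west r c = i + 1 ∧ h.dream.south r c = k) := by
  by_cases e1 : r = i + 1
  · subst e1
    left
    have hsh := h.dream.inShape _ _ hc
    rw [cross_row1] at hc
    simp only [decide_eq_true_eq] at hc
    constructor
    · exact h.dream.west_eq_of_cross _ _ (fun v hv => by rw [cross_row1]; simp; omega)
    · rintro ⟨-, hs⟩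
      have := h.shape_k
      have := h.dream.south_inj hsh (by omega) (hs.trans (h.south_high h.hk h.hkN).symm)
      omega
  by_cases e2 : r = i
  · subst e2
    have hc' := hc
    rw [cross_row0] at hc
    simp only [decide_eq_true_eq] at hc
    rcases hc with hc | hc
    · left
      refine ⟨h.dream.west_eq_of_cross _ _ (fun v hv => by rw [cross_row0]; simp; omega), by omega⟩
    · right
      subst hc
      exact ⟨rfl, rfl, h.west_sp, h.south_sp⟩
  · left
    refine ⟨h.dream.west_eq_of_cross _ _ (fun v hv => ?_), by omega⟩
    rw [h.cross_normal e2 e1] at hc ⊢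
    omega

lemma reduced : h.dream.Reduced := by
  intro r c r' c' hc hc' hne hh
  have s1 := h.dream.inShape _ _ hc
  have s2 := h.dream.inShape _ _ hc'
  have b1 := h.dream.south_mem s1
  have b2 := h.dream.south_mem s2
  have hk := h.hk
  rcases h.cross_cases hc with ⟨w, n⟩ | ⟨x1, x2, x3, x4⟩ <;>
  rcases h.cross_cases hc' with ⟨w', n'⟩ | ⟨y1, y2, y3, y4⟩
  · rcases hh with ⟨e1, e2⟩ | ⟨e1, e2⟩
    · obtain rfl : r = r' := by omega
      exact hne (by rw [h.dream.south_inj s1 s2 e2])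
    · omega
  · rcases hh with ⟨e1, e2⟩ | ⟨e1, e2⟩
    · exact n ⟨by omega, by omega⟩
    · omega
  · rcases hh with ⟨e1, e2⟩ | ⟨e1, e2⟩
    · exact n' ⟨by omega, by omega⟩
    · omega
  · exact hne (by rw [x1, x2, y1, y2])

lemma not_acyclic : ¬ h.dream.Acyclic := by
  intro hac
  have hk := h.hk
  have hN := h.hkN
  have hi := h.hi
  have arc1 : h.dream.Arc (i+1) k := by
    refine ⟨i+1, dnum N pos (i+2) k, by have := h.shape_k; omega, by rw [cross_row1]; simp,
      h.west_row1, h.south_high h.hk h.hkN⟩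
  have hrow : ∀ c, h.dream.cross 0 c = false := by
    intro c
    have := h.cross_normal (r := 0) (c := c) (by omega) (by omega)
    have h0 : dnum N pos 1 0 = 0 := by
      unfold dnum; rw [h.zero]; simp
    simp [h0] at this; exact this
  have arc2 : ∀ c, c + 2 ≤ N → h.dream.Arc (h.dream.north 0 c) (h.dream.north 0 (c+1)) := by
    intro c hc
    refine ⟨0, c, by omega, hrow c, (h.dream.north_elbow (hrow c)).symm, ?_⟩
    rw [h.dream.north_elbow (hrow _), h.dream.west_succ_elbow (hrow c)]
  have path : ∀ t c, c + t + 2 ≤ N →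
      Relation.TransGen h.dream.Arc (h.dream.north 0 c) (h.dream.north 0 (c+t+1)) := by
    intro t
    induction t with
    | zero => intro c hc; exact .single (arc2 c (by omega))
    | succ t ih => intro c hc; exact (ih c (by omega)).tail (arc2 (c+t+1) (by omega))
  have hj : pos (i+1) < N := h.bij.mapsTo (show i+1 < N by omega)
  have hkj := h.kj
  have := path (pos (i+1) - pos k - 1) (pos k) (by omega)
  rw [h.exit hN, show pos k + (pos (i+1) - pos k - 1) + 1 = pos (i+1) by omega,
    h.exit (by omega)] at this
  exact hac k (this.tail arc1)

end SpData

/-- Existence of special data from a pattern. -/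
lemma exists_spData {N : ℕ} {pos : ℕ → ℕ} (bij : Set.BijOn pos (Set.Iio N) (Set.Iio N))
    (zero : pos 0 = 0) : ∀ t i j k : ℕ, j ≤ i + t → 1 ≤ i → i < j → j < k → k < N →
    pos i < pos k → pos k < pos j → ∃ i k, SpData N pos i k := by
  intro t
  induction t with
  | zero => intros; omega
  | succ t ih =>
    intro i j k hj hi hij hjk hk h1 h2
    by_cases e : j = i + 1
    · subst e
      obtain ⟨m, hm, hmax⟩ := Finset.exists_max_image
        ((Finset.Ico (i+2) N).filter (fun m => pos m < pos (i+1))) pos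
        ⟨k, by simp; omega⟩
      simp only [Finset.mem_filter, Finset.mem_Ico] at hm hmax
      have := hmax k (by omega)
      exact ⟨i, m, bij, zero, hi, hm.1.1, hm.1.2, by omega, hm.2,
        fun l a b c => hmax l ⟨⟨a, b⟩, c⟩⟩
    · have hne : pos (i+1) ≠ pos k := fun e' => by
        have := bij.injOn (show i+1 < N by omega) hk e'
        omega
      by_cases hp : pos (i+1) < pos k
      · exact ih (i+1) j k (by omega) (by omega) (by omega) hjk hk hp h2
      · exact ih i (i+1) k (by omega) hi (by omega) (by omega) hk h1 (by omega)

/-- For a permutation `ω ∈ S_n`, all reduced pipe dreams of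
`Π(0ω)` are acyclic if and only if `ω` is dominant, i.e. `ω` avoids the pattern
`132` (there are no positions `p < q < r` with `ω p < ω r < ω q`).  Here `0ω` is
the permutation of `{0, 1, …, n}` fixing `0` and acting as `ω` on `{1, …, n}`
(everything `0`-indexed on the `ω` side), and the pipe dreams of `Π(0ω)` have
`n + 1` pipes indexed by `0, 1, …, n`. -/
theorem all_acyclic_iff_dominant (n : ℕ) (ω : Equiv.Perm (Fin n))
    (ωext : Equiv.Perm (Fin (n + 1)))
    (h0 : ωext 0 = 0) (hext : ∀ k : Fin n, ωext k.succ = (ω k).succ) :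
    (∀ P : PipeDream (n + 1), P.Reduced → P.HasExitPerm ωext → P.Acyclic) ↔
      ¬ ∃ p q r : Fin n, p < q ∧ q < r ∧ ω p < ω r ∧ ω r < ω q := by
  constructor
  · rintro hall ⟨p, q, r, hpq, hqr, h1, h2⟩
    let pos : ℕ → ℕ := fun l => if h : l < n + 1 then (ωext.symm ⟨l, h⟩).val else 0
    have hpos : ∀ c : Fin (n+1), pos (ωext c).val = c.val := by
      intro c; simp only [pos, dif_pos (ωext c).isLt, Fin.eta, Equiv.symm_apply_apply]
    have hposs : ∀ c : Fin n, pos ((ω c).val + 1) = c.val + 1 := by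
      intro c
      have := hpos c.succ
      rw [hext] at this; simpa using this
    have bij : Set.BijOn pos (Set.Iio (n+1)) (Set.Iio (n+1)) := by
      refine ⟨?_, ?_, ?_⟩
      · intro l hl
        have hl : l < n + 1 := hl
        show pos l < n + 1
        simp only [pos, dif_pos hl]
        exact (ωext.symm ⟨l, hl⟩).isLt
      · intro l hl m hm e
        have hl : l < n + 1 := hl
        have hm : m < n + 1 := hm
        simp only [pos, hl, hm, dif_pos] at e
        have := ωext.symm.injective (Fin.ext e)
        simpa using this
      · intro x hx
        exact ⟨(ωext ⟨x, hx⟩).val, (ωext ⟨x, hx⟩).isLt, hpos _⟩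
    have hz : pos 0 = 0 := by
      have := hpos 0
      rw [h0] at this; simpa using this
    obtain ⟨i, k, h⟩ := exists_spData bij hz ((ω r).val + 1) ((ω p).val + 1) ((ω r).val + 1)
      ((ω q).val + 1) (by omega) (by omega) (by omega) (by omega) (by omega)
      (by rw [hposs, hposs]; omega) (by rw [hposs, hposs]; omega)
    refine h.not_acyclic (hall h.dream h.reduced ?_)
    intro c
    rw [PipeDream.exitPipe_eq]
    have := h.exit (l := (ωext c).val) (ωext c).isLt
    rwa [hpos] at this
  · intro hno P hR hE
    apply P.acyclic_of_dom hR
    have hcol : ∀ c : Fin (n+1), P.col 0 (ωext c).val = c.val := fun c =>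
      P.col_eq (by omega) (by rw [← P.exitPipe_eq, hE c])
    have hex : ∀ l, 1 ≤ l → l < n + 1 → ∃ c : Fin n, l = (ω c).val + 1 ∧ P.col 0 l = c.val + 1 := by
      intro l hl hlN
      refine ⟨ω.symm ⟨l - 1, by omega⟩, by simp; omega, ?_⟩
      have := hcol (ω.symm ⟨l - 1, by omega⟩).succ
      rw [hext] at this
      simp only [Equiv.apply_symm_apply, Fin.val_succ] at this
      rwa [Nat.sub_add_cancel hl] at this
    intro h c d hh hhc hcd hd e1 e2
    obtain ⟨p, p1, p2⟩ := hex h hh (by omega)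
    obtain ⟨q, q1, q2⟩ := hex d (by omega) hd
    obtain ⟨r, r1, r2⟩ := hex c (by omega) (by omega)
    exact hno ⟨p, q, r, by omega, by omega, by omega, by omega⟩
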